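/- Let F be an algebraically closed field of positive characteristic p, and let n ≥ 6 be a natural number with p not dividing n. If M is an m × m matrix whose entries are polynomials of degree at most 1 in F[x_1, ..., x_n] such that det(M) = ∑_{i=1}^n x_i^n as polynomials, then 2m ≥ 3n − 6. -/

import Mathlib

open MvPolynomial

namespace Matrix

variable {R U V : Type*} [CommRing R] [Fintype U] [DecidableEq U] [Fintype V] [DecidableEq V]

/-- Division-free form of the Schur complement formula. -/
theorem det_fromBlocks_mul_pow_card (A : Matrix U U R) (B : Matrix U V R) (C : Matrix V U R)
    (D : Matrix V V R) :
    (fromBlocks A B C D).det * D.det ^ Fintype.card U =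
      (D.det • A - B * D.adjugate * C).det * D.det := by
  have h : fromBlocks A B C D * fromBlocks (D.det • (1 : Matrix U U R)) 0 (-(D.adjugate * C)) 1 =
      fromBlocks (D.det • A - B * D.adjugate * C) B 0 D := by
    rw [fromBlocks_multiply]
    congr 1
    · simp [sub_eq_add_neg, Matrix.mul_assoc]
    · simp
    · simp [← Matrix.mul_assoc, mul_adjugate]
    · simp
  have h' := congrArg det h
  rw [det_mul, det_fromBlocks_zero₁₂, det_fromBlocks_zero₂₁, det_smul, det_one, det_one] at h'
  simpa using h'

/-- The Schur complement formula for a border of size one over a domain. -/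
theorem det_fromBlocks_unit [IsDomain R] (A : Matrix Unit Unit R) (B : Matrix Unit V R)
    (C : Matrix V Unit R) (D : Matrix V V R) (hD : D.det ≠ 0) :
    (fromBlocks A B C D).det = (D.det • A - B * D.adjugate * C) () () := by
  have h := det_fromBlocks_mul_pow_card A B C D
  rw [Fintype.card_unit, pow_one] at h
  rw [mul_right_cancel₀ hD h, det_unique]

end Matrix

/-- If `P * b - Q * h` lies in the square of a prime `p`, with `b` outside and `Q` in `p`, and `h`
is congruent to `c * b`, then `d P` is congruent to `c * d Q`. -/
theorem Derivation.sub_mul_mem_of_mul_eq {k R ι : Type*} [CommRing k] [CommRing R] [Algebra k R]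
    [Fintype ι] (d : Derivation k R R) (p : Ideal R) [p.IsPrime] {P Q b h c : R} {u v : ι → R}
    (hP : P * b = Q * h - ∑ i, u i * v i) (hb : b ∉ p) (hQ : Q ∈ p) (hu : ∀ i, u i ∈ p)
    (hv : ∀ i, v i ∈ p) (hh : h - c * b ∈ p) : d P - c * d Q ∈ p := by
  have hPp : P ∈ p := by
    refine (Ideal.IsPrime.mem_or_mem ‹_› (?_ : P * b ∈ p)).resolve_right hb
    rw [hP]
    exact sub_mem (p.mul_mem_right _ hQ) (sum_mem fun i _ => p.mul_mem_right _ (hu i))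
  have hd := congrArg d hP
  simp only [map_sub, map_sum, Derivation.leibniz, smul_eq_mul] at hd
  refine (Ideal.IsPrime.mem_or_mem ‹_› (?_ : b * (d P - c * d Q) ∈ p)).resolve_left hb
  have : b * (d P - c * d Q) = Q * d h - ∑ i, (u i * d (v i) + v i * d (u i)) - P * d b
      + (h - c * b) * d Q := by linear_combination hd
  rw [this]
  exact add_mem (sub_mem (sub_mem (p.mul_mem_right _ hQ) (sum_mem fun i _ =>
    add_mem (p.mul_mem_right _ (hu i)) (p.mul_mem_right _ (hv i)))) (p.mul_mem_right _ hPp))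
    (p.mul_mem_right _ hh)

namespace MvPolynomial

theorem totalDegree_det_le {R σ ι : Type*} [CommRing R] [Fintype ι] [DecidableEq ι]
    (M : Matrix ι ι (MvPolynomial σ R)) (hM : ∀ i j, (M i j).totalDegree ≤ 1) :
    M.det.totalDegree ≤ Fintype.card ι := by
  rw [Matrix.det_apply]
  refine totalDegree_finsetSum_le fun τ _ => (totalDegree_smul_le _ _).trans ?_
  refine (totalDegree_finsetProd _ _).trans ((Finset.sum_le_sum fun i _ => hM _ _).trans ?_)
  simp

theorem totalDegree_pderiv_le {R σ : Type*} [CommSemiring R] (i : σ) (f : MvPolynomial σ R) :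
    (pderiv i f).totalDegree ≤ f.totalDegree - 1 := by
  refine Finset.sup_le fun m hm => Nat.le_sub_one_of_lt ?_
  have hm' : m + Finsupp.single i 1 ∈ f.support := by
    rw [mem_support_iff, coeff_pderiv] at hm
    exact mem_support_iff.mpr (left_ne_zero_of_mul hm)
  refine lt_of_lt_of_le ?_ (le_totalDegree hm')
  rw [Finsupp.sum_add_index' (fun _ => rfl) (fun _ _ _ => rfl), Finsupp.sum_single_index rfl]
  exact Nat.lt_succ_self _

/-- A quotient of a polynomial ring in which the `d`-th power of each variable is a polynomial of
degree less than `d` is finite. -/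
theorem finite_quotient_of_pow_sub_mem {F σ : Type*} [Field F] [Fintype σ]
    (I : Ideal (MvPolynomial σ F)) (d : ℕ) (r : σ → MvPolynomial σ F)
    (hr : ∀ i, (r i).totalDegree < d) (h : ∀ i, X i ^ d - r i ∈ I) :
    Module.Finite F (MvPolynomial σ F ⧸ I) := by
  classical
  set W := restrictTotalDegree σ F (Fintype.card σ * d)
  have key : ∀ N, ∀ f : MvPolynomial σ F, f.totalDegree ≤ N → f ∈ W ⊔ I.restrictScalars F := by
    intro N
    induction N using Nat.strong_induction_on with
    | _ N ih =>
      intro f hf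
      rw [f.as_sum]
      refine Submodule.sum_mem _ fun s hs => ?_
      have hsN : s.degree ≤ N := (le_totalDegree hs).trans hf
      by_cases hsd : s.degree ≤ Fintype.card σ * d
      · exact Submodule.mem_sup_left ((mem_restrictTotalDegree _ _ _).mpr
          ((totalDegree_monomial_le _ _).trans hsd))
      · obtain ⟨i, hi⟩ : ∃ i, d ≤ s i := by
          by_contra! hlt
          refine hsd ?_
          rw [Finsupp.degree_eq_sum]
          simpa using Finset.sum_le_sum fun i (_ : i ∈ Finset.univ) => (hlt i).le
        obtain ⟨t, rfl⟩ : ∃ t, s = t + Finsupp.single i d :=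
          ⟨s - Finsupp.single i d, (tsub_add_cancel_of_le (by simpa using hi)).symm⟩
        set a := coeff (t + Finsupp.single i d) f
        have hsplit : monomial (t + Finsupp.single i d) a =
            monomial t a * r i + monomial t a * (X i ^ d - r i) := by
          rw [X_pow_eq_monomial, mul_sub, monomial_mul, mul_one]
          ring
        have hdeg : (monomial t a * r i).totalDegree ≤ t.degree + (r i).totalDegree :=
          (totalDegree_mul _ _).trans (Nat.add_le_add_right (totalDegree_monomial_le _ _) _)
        rw [map_add, Finsupp.degree_single] at hsN
        have := hr i
        rw [hsplit]
        exact add_mem (ih _ (by omega) _ hdeg)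
          (Submodule.mem_sup_right (I.mul_mem_left _ (h i)))
  refine Module.Finite.of_surjective
    ((Ideal.Quotient.mkₐ F I).toLinearMap ∘ₗ W.subtype) fun y => ?_
  obtain ⟨f, rfl⟩ := Ideal.Quotient.mk_surjective y
  obtain ⟨g, hg, k, hk, rfl⟩ := Submodule.mem_sup.mp (key _ f le_rfl)
  refine ⟨⟨g, hg⟩, ?_⟩
  simpa using Ideal.Quotient.eq_zero_iff_mem.mpr hk

/-- The vanishing ideal of a point of affine `n`-space has height at least `n`. -/
theorem le_height_ker_eval {F : Type*} [Field F] {n : ℕ} (x : Fin n → F) :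
    (n : ℕ∞) ≤ (RingHom.ker (eval x)).height := by
  let φ (k : ℕ) : MvPolynomial (Fin n) F →ₐ[F] MvPolynomial (Fin n) F :=
    aeval fun i => if i.1 < k then C (x i) else X i
  have hφ (k : ℕ) (f : MvPolynomial (Fin n) F) : φ (k + 1) (φ k f) = φ (k + 1) f := by
    suffices h : (φ (k + 1)).comp (φ k) = φ (k + 1) from AlgHom.congr_fun h f
    refine algHom_ext fun i => ?_
    by_cases hi : i.1 < k
    · simp [φ, hi, hi.le]
    · simp [φ, hi]
  have hk : ∀ k ≤ n, (k : ℕ∞) ≤ (RingHom.ker (φ k)).height := by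
    intro k
    induction k with
    | zero => simp
    | succ k ih =>
      intro hkn
      have hlt : RingHom.ker (φ k) < RingHom.ker (φ (k + 1)) := by
        refine SetLike.lt_iff_le_and_exists.mpr
          ⟨fun f hf => ?_, X ⟨k, hkn⟩ - C (x ⟨k, hkn⟩), ?_, ?_⟩
        · rw [RingHom.mem_ker] at hf ⊢
          rw [← hφ, hf, map_zero]
        · simp [φ, RingHom.mem_ker]
        · intro h0
          have h0 : (X ⟨k, hkn⟩ - C (x ⟨k, hkn⟩) : MvPolynomial (Fin n) F) = 0 := by
            simpa [φ, RingHom.mem_ker] using h0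
          simpa using congrArg (pderiv ⟨k, hkn⟩) h0
      have := RingHom.ker_isPrime (φ k)
      have := RingHom.ker_isPrime (φ (k + 1))
      push_cast
      exact (add_le_add_left (ih (by omega)) 1).trans (Ideal.height_add_one_le_of_lt_of_isPrime hlt)
  refine (hk n le_rfl).trans (Ideal.height_mono fun f hf => ?_)
  have hC : φ n f = C (eval x f) := by
    have h : φ n = (Algebra.ofId F _).comp (aeval x) := algHom_ext fun i => by
      simp [φ, Algebra.ofId_apply, algebraMap_eq]
    simpa [Algebra.ofId_apply, algebraMap_eq, aeval_eq_eval] using AlgHom.congr_fun h f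
  rw [RingHom.mem_ker, hC] at hf
  simpa [RingHom.mem_ker] using hf

open Matrix in
/-- If a matrix of affine forms is diagonal at `x`, with exactly one zero on the diagonal there, then
its determinant is locally at `x` congruent to a multiple of the minor obtained by deleting the rows
and columns in `S`, up to a sum of `card S` products of polynomials vanishing at `x`. -/
theorem exists_det_mul_eq_sub_sum_mul {F : Type*} [Field F] {n : ℕ} {S T : Type*} [Fintype S]
    [DecidableEq S] [Fintype T] [DecidableEq T] (x : Fin n → F)
    (N : Matrix ((Unit ⊕ S) ⊕ T) ((Unit ⊕ S) ⊕ T) (MvPolynomial (Fin n) F))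
    (hN : ∀ i j, (N i j).totalDegree ≤ 1) (D : (Unit ⊕ S) ⊕ T → F)
    (hD : N.map (eval x) = diagonal D) (hD0 : D (.inl (.inl ())) = 0)
    (hD1 : ∀ i, i ≠ .inl (.inl ()) → D i ≠ 0) :
    ∃ (Q b h : MvPolynomial (Fin n) F) (u v : S → MvPolynomial (Fin n) F),
      N.det * b = Q * h - ∑ s, u s * v s ∧ eval x b ≠ 0 ∧ eval x Q = 0 ∧
      (∀ s, eval x (u s) = 0) ∧ (∀ s, eval x (v s) = 0) ∧
      Q.totalDegree ≤ Fintype.card T + 1 := by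
  classical
  have hNx : ∀ i j, eval x (N i j) = diagonal D i j := fun i j => congrFun (congrFun hD i) j
  set β := N.toBlocks₂₂.det with hβ
  have hβx : eval x β ≠ 0 := by
    have : N.toBlocks₂₂.map (eval x) = diagonal fun t => D (.inr t) := by
      ext i j
      simp [toBlocks₂₂, hNx, diagonal_apply]
    rw [hβ, RingHom.map_det, RingHom.mapMatrix_apply, this, det_diagonal]
    exact Finset.prod_ne_zero_iff.mpr fun t _ => hD1 _ (by simp)
  have hβ0 : β ≠ 0 := fun h => hβx (by rw [h, map_zero])
  set K := β • N.toBlocks₁₁ - N.toBlocks₁₂ * N.toBlocks₂₂.adjugate * N.toBlocks₂₁ with hK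
  have hKx : ∀ i j, eval x (K i j) = eval x β * diagonal (fun u => D (.inl u)) i j := by
    intro i j
    have h12 : ∀ t, eval x (N.toBlocks₁₂ i t) = 0 := fun t => by simp [toBlocks₁₂, hNx]
    simp [hK, mul_apply, h12, toBlocks₁₁, hNx, diagonal_apply]
  have hdetK : N.det * β ^ Fintype.card S = K.det := by
    have h := det_fromBlocks_mul_pow_card N.toBlocks₁₁ N.toBlocks₁₂ N.toBlocks₂₁ N.toBlocks₂₂
    rw [fromBlocks_toBlocks] at h
    refine mul_right_cancel₀ hβ0 (Eq.trans ?_ h)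
    simp [pow_succ', pow_add]
    ring
  set H := K.toBlocks₂₂ with hH
  have hHx : eval x H.det ≠ 0 := by
    have : H.map (eval x) = eval x β • diagonal fun s => D (.inl (.inr s)) := by
      ext i j
      simp [hH, toBlocks₂₂, hKx, diagonal_apply]
    rw [RingHom.map_det, RingHom.mapMatrix_apply, this, det_smul, det_diagonal]
    exact mul_ne_zero (pow_ne_zero _ hβx)
      (Finset.prod_ne_zero_iff.mpr fun t _ => hD1 _ (by simp))
  have hH0 : H.det ≠ 0 := fun h => hHx (by rw [h, map_zero])
  let u : S → MvPolynomial (Fin n) F := fun s => K (.inl ()) (.inr s)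
  let v : S → MvPolynomial (Fin n) F := fun s => K (.inr s) (.inl ())
  let Q := K (.inl ()) (.inl ())
  refine ⟨Q, β ^ Fintype.card S, H.det, u, fun s => ∑ t, H.adjugate s t * v t,
    ?_, ?_, ?_, ?_, ?_, ?_⟩
  · have h := det_fromBlocks_unit K.toBlocks₁₁ K.toBlocks₁₂ K.toBlocks₂₁ K.toBlocks₂₂ hH0
    rw [fromBlocks_toBlocks] at h
    rw [hdetK, h, Matrix.mul_assoc]
    simp [mul_apply, toBlocks₁₁, toBlocks₁₂, toBlocks₂₁, u, v, Q, hH, mul_comm]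
  · rw [map_pow]
    exact pow_ne_zero _ hβx
  · simp [Q, hKx, hD0]
  · simp [u, hKx]
  · simp [v, hKx]
  · let N' := N.submatrix (Sum.map (Sum.inl : Unit → Unit ⊕ S) (id : T → T))
      (Sum.map (Sum.inl : Unit → Unit ⊕ S) (id : T → T))
    have hN' : N'.det = Q := by
      have h := det_fromBlocks_unit N'.toBlocks₁₁ N'.toBlocks₁₂ N'.toBlocks₂₁ N'.toBlocks₂₂ hβ0
      rw [fromBlocks_toBlocks] at h
      exact h
    rw [← hN']
    refine (totalDegree_det_le N' fun i j => hN _ _).trans ?_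
    simp [add_comm]

/-- If `P * b - Q * h` is a sum of `card S` products of polynomials vanishing at `x`, where `Q`
vanishes at `x` and `b` does not, then along an irreducible variety through `x` cut out by
`2 * card S + 2` equations the gradient of `P` is proportional to that of `Q`. -/
theorem exists_prime_pderiv_sub_mem {F : Type*} [Field F] {n : ℕ} {S : Type*} [Fintype S]
    (x : Fin n → F) {P Q b h : MvPolynomial (Fin n) F} {u v : S → MvPolynomial (Fin n) F}
    (hP : P * b = Q * h - ∑ s, u s * v s) (hb : eval x b ≠ 0) (hQ : eval x Q = 0)
    (hu : ∀ s, eval x (u s) = 0) (hv : ∀ s, eval x (v s) = 0) :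
    ∃ (p : Ideal (MvPolynomial (Fin n) F)) (c : F),
      p.IsPrime ∧ p ≤ RingHom.ker (eval x) ∧ p.height ≤ (2 * Fintype.card S + 2 : ℕ) ∧
      ∀ i, pderiv i P - C c * pderiv i Q ∈ p := by
  classical
  obtain ⟨c, hc⟩ : ∃ c : F, eval x (h - C c * b) = 0 :=
    ⟨eval x h / eval x b, by simp [div_mul_cancel₀ _ hb]⟩
  let G : Finset (MvPolynomial (Fin n) F) :=
    {Q, h - C c * b} ∪ (Finset.univ.image u ∪ Finset.univ.image v)
  have hG : Ideal.span (G : Set (MvPolynomial (Fin n) F)) ≤ RingHom.ker (eval x) := by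
    rw [Ideal.span_le]
    intro g hg
    simp only [G, Finset.mem_coe, Finset.mem_union, Finset.mem_insert, Finset.mem_singleton,
      Finset.mem_image, Finset.mem_univ, true_and] at hg
    rw [SetLike.mem_coe, RingHom.mem_ker]
    obtain (rfl | rfl) | ⟨s, rfl⟩ | ⟨s, rfl⟩ := hg
    exacts [hQ, hc, hu s, hv s]
  have := RingHom.ker_isPrime (eval x)
  obtain ⟨p, hp, hpx⟩ := Ideal.exists_minimalPrimes_le hG
  have hpp := hp.isPrime
  have hGp : ∀ g ∈ G, g ∈ p := fun g hg => hp.1.2 (Ideal.subset_span hg)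
  refine ⟨p, c, hpp, hpx, ?_, fun i => ?_⟩
  · refine (Ideal.height_le_card_of_mem_minimalPrimes_span_finset hp).trans (Nat.cast_le.mpr ?_)
    have h1 : G.card ≤ _ := Finset.card_union_le _ _
    have h2 := Finset.card_union_le (Finset.univ.image u) (Finset.univ.image v)
    have h3 : (Finset.univ.image u).card ≤ Fintype.card S := Finset.card_image_le
    have h4 : (Finset.univ.image v).card ≤ Fintype.card S := Finset.card_image_le
    have h5 := Finset.card_le_two (a := Q) (b := h - C c * b)
    omega
  · exact (pderiv i).sub_mul_mem_of_mul_eq p hP (fun h => hb (hpx h)) (hGp _ (by simp [G]))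
      (fun s => hGp _ (by simp [G])) (fun s => hGp _ (by simp [G])) (hGp _ (by simp [G]))

open Matrix in
/-- Constant transvections bring a matrix of affine forms to one that is diagonal at `x`. -/
theorem exists_det_eq_map_eval_eq_diagonal {F : Type*} [Field F] {σ ι : Type*} [Fintype ι]
    [DecidableEq ι] (M : Matrix ι ι (MvPolynomial σ F)) (hM : ∀ i j, (M i j).totalDegree ≤ 1)
    (x : σ → F) :
    ∃ (N : Matrix ι ι (MvPolynomial σ F)) (D : ι → F), N.det = M.det ∧
      (∀ i j, (N i j).totalDegree ≤ 1) ∧ N.map (eval x) = diagonal D := by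
  obtain ⟨L, L', D, hD⟩ :=
    Pivot.exists_list_transvec_mul_mul_list_transvec_eq_diagonal (M.map (eval x))
  set A := (L.map TransvectionStruct.toMatrix).prod with hA
  set B := (L'.map TransvectionStruct.toMatrix).prod with hB
  have hCmap (E : Matrix ι ι F) : (E.map (C : F →+* MvPolynomial σ F)).map (eval x) = E := by
    ext
    simp
  refine ⟨A.map C * M * B.map C, D, ?_, fun i j => ?_, ?_⟩
  · have hdet (E : Matrix ι ι F) (hE : E.det = 1) :
        (E.map (C : F →+* MvPolynomial σ F)).det = 1 := by
      rw [← RingHom.mapMatrix_apply, ← RingHom.map_det, hE, map_one]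
    rw [det_mul, det_mul, hdet A (TransvectionStruct.det_toMatrix_prod L),
      hdet B (TransvectionStruct.det_toMatrix_prod L'), one_mul, mul_one]
  · rw [mul_apply]
    refine totalDegree_finsetSum_le fun k _ => ?_
    rw [mul_apply, Finset.sum_mul]
    refine totalDegree_finsetSum_le fun l _ => ?_
    refine (totalDegree_mul _ _).trans ?_
    refine (Nat.add_le_add_right (totalDegree_mul _ _) _).trans ?_
    simpa using hM l k
  · rw [Matrix.map_mul, Matrix.map_mul, hCmap, hCmap, hD]

open Matrix in
/-- A determinant of corank at least two at `x` is singular at `x`. -/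
theorem eval_pderiv_det_eq_zero {F : Type*} [Field F] {σ ι : Type*} [Fintype ι]
    [DecidableEq ι] (N : Matrix ι ι (MvPolynomial σ F)) (x : σ → F) (D : ι → F)
    (hD : N.map (eval x) = diagonal D) {i j : ι} (hij : i ≠ j) (hi : D i = 0) (hj : D j = 0)
    (k : σ) : eval x (pderiv k N.det) = 0 := by
  have hN (l : ι) : eval x (N i l) = 0 := by
    have h := congrFun (congrFun hD i) l
    rw [map_apply, diagonal_apply] at h
    rw [h]
    split_ifs <;> simp [hi]
  have hadj (l : ι) : eval x (N.adjugate l i) = 0 := by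
    have h := congrFun (congrFun (RingHom.map_adjugate (eval x) N) l) i
    rw [RingHom.mapMatrix_apply, RingHom.mapMatrix_apply, hD, adjugate_diagonal, map_apply,
      diagonal_apply] at h
    rw [h]
    split_ifs with hl
    · subst hl
      exact Finset.prod_eq_zero (Finset.mem_erase.mpr ⟨hij.symm, Finset.mem_univ j⟩) hj
    · rfl
  rw [det_eq_sum_mul_adjugate_row N i, map_sum, map_sum]
  refine Finset.sum_eq_zero fun l _ => ?_
  simp [hN, hadj]

/-- The gradient of a power sum of degree `n` is nowhere proportional, along a positive-dimensional
variety, to the gradient of a polynomial of degree less than `n`. -/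
theorem le_height_of_pderiv_sum_pow_sub_mem {F : Type*} [Field F] {n : ℕ} (hn : 2 ≤ n)
    (hnF : (n : F) ≠ 0) (x : Fin n → F) (p : Ideal (MvPolynomial (Fin n) F)) [p.IsPrime]
    (hpx : p ≤ RingHom.ker (eval x)) (Q : MvPolynomial (Fin n) F) (hQ : Q.totalDegree < n) (c : F)
    (h : ∀ i, pderiv i (∑ j : Fin n, X j ^ n) - C c * pderiv i Q ∈ p) :
    (n : ℕ∞) ≤ p.height := by
  have hfin : Module.Finite F (MvPolynomial (Fin n) F ⧸ p) := by
    refine finite_quotient_of_pow_sub_mem p (n - 1)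
      (fun i => C ((n : F)⁻¹ * c) * pderiv i Q) (fun i => ?_) fun i => ?_
    · have h1 := totalDegree_mul (C ((n : F)⁻¹ * c)) (pderiv i Q)
      have h2 := totalDegree_pderiv_le i Q
      rw [totalDegree_C] at h1
      omega
    · have hd : pderiv i (∑ j : Fin n, X j ^ n : MvPolynomial (Fin n) F) =
          C (n : F) * X i ^ (n - 1) := by
        rw [map_sum, Finset.sum_eq_single i]
        · simp
        · intro j _ hj
          simp [pderiv_X_of_ne hj]
        · simp
      have hmem := p.mul_mem_left (C (n : F)⁻¹) (h i)
      rwa [hd, mul_sub, ← mul_assoc, ← mul_assoc, ← C_mul, ← C_mul, inv_mul_cancel₀ hnF, C_1,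
        one_mul] at hmem
  have hmax : p.IsMaximal :=
    Ideal.Quotient.maximal_of_isField _ (isField_of_isIntegral_of_isField' (Field.toIsField F))
  have := RingHom.ker_isPrime (eval x)
  rw [hmax.eq_of_le (Ideal.IsPrime.ne_top ‹_›) hpx]
  exact le_height_ker_eval x

/-- The hypersurface `∑ i, x i ^ n = 0` over an algebraically closed field has a point with a
coordinate equal to one. -/
theorem exists_eval_sum_pow_eq_zero {F : Type*} [Field F] [IsAlgClosed F] {n : ℕ} (hn : 2 ≤ n) :
    ∃ (x : Fin n → F) (i : Fin n), x i = 1 ∧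
      eval x (∑ j : Fin n, X j ^ n : MvPolynomial (Fin n) F) = 0 := by
  obtain ⟨z, hz⟩ := IsAlgClosed.exists_pow_nat_eq (-1 : F) (n := n) (by omega)
  obtain ⟨k, rfl⟩ := Nat.exists_eq_add_of_le' hn
  refine ⟨Fin.cons 1 (Fin.cons z 0), 0, rfl, ?_⟩
  simp [Fin.sum_univ_succ, hz]

end MvPolynomial

/-- Over an algebraically closed field `F` of positive characteristic `p`
with `p ∤ n` and `n ≥ 6`: if `M` is an `m × m` matrix whose entries are polynomials of
degree at most 1 in `F[x_1, …, x_n]` with `det M = ∑_{i=1}^n x_i^n`, then `2m ≥ 3n - 6`. -/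
theorem dc_power_sum_lower_bound_char_p
    (F : Type*) [Field F] [IsAlgClosed F] (p : ℕ) [CharP F p] (hp : 0 < p)
    (n m : ℕ) (hn : 6 ≤ n) (hpn : ¬ p ∣ n)
    (M : Matrix (Fin m) (Fin m) (MvPolynomial (Fin n) F))
    (hdeg : ∀ i j, (M i j).totalDegree ≤ 1)
    (hdet : M.det = ∑ i : Fin n, X i ^ n) :
    2 * m ≥ 3 * n - 6 := by
  by_contra! hlt
  have hnF : (n : F) ≠ 0 := fun h => hpn ((CharP.cast_eq_zero_iff F p n).mp h)
  obtain ⟨x, k, hk, hx⟩ := exists_eval_sum_pow_eq_zero (F := F) (n := n) (by omega)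
  obtain ⟨N, D, hNdet, hNdeg, hND⟩ := exists_det_eq_map_eval_eq_diagonal M hdeg x
  rw [hdet] at hNdet
  obtain ⟨i₀, hi₀⟩ : ∃ i, D i = 0 := by
    rw [← hNdet, RingHom.map_det, RingHom.mapMatrix_apply, hND, Matrix.det_diagonal,
      Finset.prod_eq_zero_iff] at hx
    simpa using hx
  have hne : ∀ i, i ≠ i₀ → D i ≠ 0 := by
    intro i hi h0
    have h := eval_pderiv_det_eq_zero N x D hND hi h0 hi₀ k
    rw [hNdet, map_sum, map_sum, Finset.sum_eq_single k] at h
    · simp [hk, hnF] at h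
    · intro j _ hj
      simp [pderiv_X_of_ne hj]
    · simp
  have hm : 0 < m := i₀.pos
  obtain ⟨s, t, hst, ht, hs⟩ : ∃ s t, m = 1 + s + t ∧ t + 1 < n ∧ 2 * s + 2 < n :=
    ⟨m + 1 - n, m - 1 - (m + 1 - n), by omega, by omega, by omega⟩
  obtain ⟨e, he⟩ : ∃ e : Fin m ≃ (Unit ⊕ Fin s) ⊕ Fin t, e i₀ = .inl (.inl ()) := by
    let f : Fin m ≃ (Unit ⊕ Fin s) ⊕ Fin t := Fintype.equivOfCardEq (by simp [hst])
    exact ⟨f.trans (Equiv.swap (f i₀) (.inl (.inl ()))), by simp⟩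
  obtain ⟨Q, b, h, u, v, hP, hb, hQ, hu, hv, hQdeg⟩ := exists_det_mul_eq_sub_sum_mul x
    (Matrix.reindex e e N) (fun i j => hNdeg _ _) (D ∘ e.symm)
    (by
      rw [Matrix.reindex_apply, ← Matrix.submatrix_map, hND, Matrix.submatrix_diagonal_equiv])
    (by simp [← he, hi₀])
    (fun i hi => hne _ fun h => hi (by rw [← he, ← h, Equiv.apply_symm_apply]))
  rw [Matrix.det_reindex_self, hNdet] at hP
  obtain ⟨q, c, hq, hqx, hqh, hmem⟩ := exists_prime_pderiv_sub_mem x hP hb hQ hu hv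
  rw [Fintype.card_fin] at hqh hQdeg
  have hle := (le_height_of_pderiv_sum_pow_sub_mem (by omega) hnF x q hqx Q (by omega) c hmem).trans
    hqh
  have := Nat.cast_le.mp hle
  omega
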